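/- Let s ∈ (0,1), v ∈ C^∞(ℝ^n) ∩ W^{1,∞}(ℝ^n), η ∈ C^∞(ℝ^n) ∩ W^{2,∞}(ℝ^n), e ∈ ℝ^n with |e| = 1, and σ > 0. Set ψ := η²(∂_e v)₊² + σ v². Then there exists a constant σ₀, depending only on n and ‖η‖_{C²(ℝ^n)} (and, in particular, independent of s), such that whenever σ ≥ σ₀ one has, everywhere in ℝ^n, (-Δ)^s ψ ≤ 2 η² (∂_e v)₊ (-Δ)^s ∂_e v + 2 σ v (-Δ)^s v. -/

import Mathlib

open MeasureTheory Filter Metric Set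

noncomputable section

/-- Euclidean space `ℝⁿ`. -/
abbrev En (n : ℕ) := EuclideanSpace ℝ (Fin n)

/-- Principal value integral centered at `x`: the limit, as `ε → 0⁺`, of the integrals
over the complement of the `ε`-ball centered at `x`. -/
def pvAt (n : ℕ) (x : En n) (g : En n → ℝ) : ℝ :=
  limUnder (nhdsWithin (0:ℝ) (Set.Ioi 0))
    (fun ε => ∫ y in {y : En n | ε ≤ dist y x}, g y)

/-- Integro-differential operator with kernel `K`:
`𝓛_K u (x) = P.V. ∫ (u x - u y) K (x - y) dy`. -/
def opK (n : ℕ) (K : En n → ℝ) (u : En n → ℝ) (x : En n) : ℝ :=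
  pvAt n x (fun y => (u x - u y) * K (x - y))

/-- The normalizing constant `c_{n,s}` of the fractional Laplacian, for which the
Fourier symbol is `|ξ|^{2s}`. -/
def cns (n : ℕ) (s : ℝ) : ℝ :=
  (4:ℝ) ^ s * s * Real.Gamma ((n:ℝ)/2 + s) / (Real.pi ^ ((n:ℝ)/2) * Real.Gamma (1 - s))

/-- The fractional Laplacian `(-Δ)^s`, for `s ∈ (0,1)`. -/
def fracLap (n : ℕ) (s : ℝ) (u : En n → ℝ) (x : En n) : ℝ :=
  opK n (fun z => cns n s * ‖z‖ ^ (-((n:ℝ) + 2*s))) u x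

/-- Directional derivative `∂_e u`. -/
def dd (n : ℕ) (e : En n) (u : En n → ℝ) (x : En n) : ℝ := fderiv ℝ u x e

/-- Second directional derivative `∂²_e u`. -/
def dd2 (n : ℕ) (e : En n) (u : En n → ℝ) (x : En n) : ℝ := fderiv ℝ (dd n e u) x e

/-- `‖η‖_{C²(ℝⁿ)} ≤ M`. -/
def C2BddBy (n : ℕ) (η : En n → ℝ) (M : ℝ) : Prop :=
  ∀ x : En n, |η x| ≤ M ∧ ‖fderiv ℝ η x‖ ≤ M ∧ ‖fderiv ℝ (fderiv ℝ η) x‖ ≤ M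

/-- The kernel `K` is even and has two-sided power bounds with constants `C₁ ≤ C₂`:
`K(z) = K(-z)` and `C₁ s(1-s)|z|^{-n-2s} ≤ K(z) ≤ C₂ s(1-s)|z|^{-n-2s}` for `z ≠ 0`. -/
def evenPowKernel (n : ℕ) (s C₁ C₂ : ℝ) (K : En n → ℝ) : Prop :=
  (∀ z : En n, z ≠ 0 → K z = K (-z)) ∧
  (∀ z : En n, z ≠ 0 →
    C₁ * (s * (1 - s)) * ‖z‖ ^ (-((n:ℝ) + 2*s)) ≤ K z ∧
    K z ≤ C₂ * (s * (1 - s)) * ‖z‖ ^ (-((n:ℝ) + 2*s)))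

/-- `K ∈ C²(ℝⁿ \ {0})` with `|z||∇K(z)| + |z|²|D²K(z)| ≤ C₃ K(z)` for `z ≠ 0`. -/
def kernelDerivBdd (n : ℕ) (C₃ : ℝ) (K : En n → ℝ) : Prop :=
  ContDiffOn ℝ 2 K {z : En n | z ≠ 0} ∧
  ∀ z : En n, z ≠ 0 →
    ‖z‖ * ‖fderiv ℝ K z‖ + ‖z‖^2 * ‖fderiv ℝ (fderiv ℝ K) z‖ ≤ C₃ * K z

/-- The symmetrized increment `f x - (f (x + z) + f (x - z)) / 2`. -/
def symmDiffAt {n : ℕ} (f : En n → ℝ) (x z : En n) : ℝ := f x - (f (x + z) + f (x - z)) / 2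

lemma integrable_min_one_sq_mul_rpow {n : ℕ} (hn : 0 < n) {s : ℝ} (hs : s ∈ Set.Ioo (0:ℝ) 1) :
    Integrable (fun z : En n => min 1 (‖z‖ ^ 2) * ‖z‖ ^ (-((n:ℝ) + 2 * s))) := by
  have : Nonempty (Fin n) := ⟨⟨0, hn⟩⟩
  obtain ⟨h0, h1⟩ := hs
  refine (integrable_fun_norm_addHaar (volume : Measure (En n))
    (f := fun t : ℝ => min 1 (t ^ 2) * t ^ (-((n:ℝ) + 2 * s)))).2 ?_
  have hcast : ((n - 1 : ℕ) : ℝ) = (n : ℝ) - 1 := by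
    rw [Nat.cast_sub hn]; simp
  rw [← Ioc_union_Ioi_eq_Ioi (zero_le_one' ℝ)]
  refine IntegrableOn.union ?_ ?_
  · have : IntegrableOn (fun t : ℝ => t ^ (1 - 2 * s)) (Ioc 0 1) := by
      rw [← intervalIntegrable_iff_integrableOn_Ioc_of_le zero_le_one]
      exact intervalIntegral.intervalIntegrable_rpow' (by linarith)
    refine this.congr_fun (fun t ht => ?_) measurableSet_Ioc
    have ht0 : 0 < t := ht.1
    have h2 : t ^ 2 ≤ 1 := by have := ht.2; nlinarith
    simp only [finrank_euclideanSpace, Fintype.card_fin, min_eq_right h2, smul_eq_mul]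
    rw [← Real.rpow_natCast t (n - 1), ← Real.rpow_natCast t 2, ← Real.rpow_add ht0,
      ← Real.rpow_add ht0, hcast]
    congr 1
    push_cast
    ring
  · have : IntegrableOn (fun t : ℝ => t ^ (-1 - 2 * s)) (Ioi 1) :=
      integrableOn_Ioi_rpow_of_lt (by linarith) one_pos
    refine this.congr_fun (fun t ht => ?_) measurableSet_Ioi
    have ht1 : 1 < t := ht
    have ht0 : 0 < t := by linarith
    have h2 : 1 ≤ t ^ 2 := by nlinarith
    simp only [finrank_euclideanSpace, Fintype.card_fin, min_eq_left h2, smul_eq_mul, one_mul]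
    rw [← Real.rpow_natCast t (n - 1), ← Real.rpow_add ht0, hcast]
    congr 1
    ring

lemma integrable_mul_rpow_of_le {n : ℕ} (hn : 0 < n) {s : ℝ} (hs : s ∈ Set.Ioo (0:ℝ) 1)
    {H : En n → ℝ} (hH : AEStronglyMeasurable H volume) {C : ℝ}
    (hC : ∀ z, |H z| ≤ C * min 1 (‖z‖ ^ 2)) :
    Integrable (fun z : En n => H z * ‖z‖ ^ (-((n:ℝ) + 2 * s))) := by
  refine ((integrable_min_one_sq_mul_rpow hn hs).const_mul C).mono' ?_ ?_
  · exact hH.mul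
      (by fun_prop : Measurable fun z : En n => ‖z‖ ^ (-((n:ℝ) + 2 * s))).aestronglyMeasurable
  · refine Eventually.of_forall fun z => ?_
    have : 0 ≤ ‖z‖ ^ (-((n:ℝ) + 2 * s)) := Real.rpow_nonneg (norm_nonneg _) _
    rw [Real.norm_eq_abs, abs_mul, abs_of_nonneg this, ← mul_assoc]
    exact mul_le_mul_of_nonneg_right (hC z) this

lemma continuous_symmDiffAt {n : ℕ} {f : En n → ℝ} (hf : Continuous f) (x : En n) :
    Continuous (symmDiffAt f x) := by
  unfold symmDiffAt; fun_prop

lemma fracLap_eq_integral_symmDiffAt {n : ℕ} (hn : 0 < n) {s : ℝ} (hs : s ∈ Set.Ioo (0:ℝ) 1)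
    {f : En n → ℝ} (hf : Continuous f) {B : ℝ} (hB : ∀ y, |f y| ≤ B) {x : En n} {C : ℝ}
    (hC : ∀ z, |symmDiffAt f x z| ≤ C * min 1 (‖z‖ ^ 2)) :
    fracLap n s f x = cns n s * ∫ z, symmDiffAt f x z * ‖z‖ ^ (-((n:ℝ) + 2 * s)) := by
  set K : En n → ℝ := fun z => ‖z‖ ^ (-((n:ℝ) + 2 * s)) with hK
  have hKm : Measurable K := by simp only [hK]; fun_prop
  have hK0 : ∀ z, 0 ≤ K z := fun z => Real.rpow_nonneg (norm_nonneg _) _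
  have hKneg : ∀ z, K (-z) = K z := fun z => by simp [hK]
  let A : ℝ → Set (En n) := fun ε => {z | ε ≤ ‖z‖}
  have hA : ∀ ε, MeasurableSet (A ε) := fun ε => measurableSet_le measurable_const measurable_norm
  have hInt := integrable_mul_rpow_of_le hn hs (continuous_symmDiffAt hf x).aestronglyMeasurable hC
  have hbase := integrable_min_one_sq_mul_rpow hn hs
  have hone : ∀ g : En n → ℝ, Continuous g → (∀ z, |g z| ≤ 2 * B) → ∀ ε > 0,
      Integrable ((A ε).indicator fun z => g z * K z) := by
    intro g hg hgB ε hε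
    refine (hbase.const_mul (2 * B / min 1 (ε ^ 2))).mono' ?_ ?_
    · exact ((hg.measurable.mul hKm).indicator (hA ε)).aestronglyMeasurable
    · refine Eventually.of_forall fun z => ?_
      have hB0 : 0 ≤ 2 * B := (abs_nonneg _).trans (hgB z)
      have hmin : 0 < min 1 (ε ^ 2) := lt_min one_pos (by positivity)
      by_cases hz : z ∈ A ε
      · rw [indicator_of_mem hz, Real.norm_eq_abs, abs_mul, abs_of_nonneg (hK0 z), ← mul_assoc]
        refine mul_le_mul_of_nonneg_right ((hgB z).trans ?_) (hK0 z)
        rw [div_mul_eq_mul_div, le_div_iff₀ hmin]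
        refine mul_le_mul_of_nonneg_left (min_le_min le_rfl ?_) hB0
        exact pow_le_pow_left₀ hε.le hz 2
      · rw [indicator_of_notMem hz, norm_zero]
        have := hK0 z
        simp only [hK] at this
        positivity
  have htrunc : ∀ ε > 0, ∫ y in {y : En n | ε ≤ dist y x}, (f x - f y) * (cns n s * K (x - y))
      = cns n s * ∫ z, (A ε).indicator (fun z => symmDiffAt f x z * K z) z := by
    intro ε hε
    have hm : MeasurableSet {y : En n | ε ≤ dist y x} :=
      measurableSet_le measurable_const (by fun_prop)
    have hb : ∀ z w : En n, |f z - f w| ≤ 2 * B := fun z w =>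
      (abs_sub _ _).trans (by linarith [hB z, hB w])
    have h1 := hone (fun z => f x - f (x + z)) (by fun_prop) (fun z => hb _ _) ε hε
    have h2 := hone (fun z => f x - f (x - z)) (by fun_prop) (fun z => hb _ _) ε hε
    have e1 : ∫ y in {y : En n | ε ≤ dist y x}, (f x - f y) * (cns n s * K (x - y))
        = cns n s * ∫ z, (A ε).indicator (fun z => (f x - f (x + z)) * K z) z := by
      rw [← integral_indicator hm, ← integral_add_left_eq_self _ x, ← integral_const_mul]
      congr 1
      ext z
      have : x - (x + z) = -z := by abel
      by_cases hz : ε ≤ ‖z‖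
      · rw [indicator_of_mem (by simpa using hz), indicator_of_mem (show z ∈ A ε from hz), this,
          hKneg]
        ring
      · rw [indicator_of_notMem (by simpa using hz), indicator_of_notMem (show z ∉ A ε from hz),
          mul_zero]
    have e2 : ∫ z, (A ε).indicator (fun z => (f x - f (x + z)) * K z) z
        = ∫ z, (A ε).indicator (fun z => (f x - f (x - z)) * K z) z := by
      rw [← integral_neg_eq_self]
      congr 1
      ext z
      by_cases hz : ε ≤ ‖z‖
      · rw [indicator_of_mem (show -z ∈ A ε by simpa [A] using hz),
          indicator_of_mem (show z ∈ A ε from hz), hKneg, sub_eq_add_neg x z]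
      · rw [indicator_of_notMem (show -z ∉ A ε by simpa [A] using hz),
          indicator_of_notMem (show z ∉ A ε from hz)]
    have e3 : ∫ z, (A ε).indicator (fun z => symmDiffAt f x z * K z) z
        = (1 / 2) * (∫ z, (A ε).indicator (fun z => (f x - f (x + z)) * K z) z)
          + (1 / 2) * ∫ z, (A ε).indicator (fun z => (f x - f (x - z)) * K z) z := by
      rw [← integral_const_mul, ← integral_const_mul,
        ← integral_add (h1.const_mul _) (h2.const_mul _)]
      congr 1
      ext z
      by_cases hz : z ∈ A ε
      · simp only [indicator_of_mem hz, symmDiffAt]; ring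
      · simp only [indicator_of_notMem hz]; ring
    rw [e1, e3, ← e2]
    ring
  have hlim : Tendsto (fun ε => ∫ z, (A ε).indicator (fun z => symmDiffAt f x z * K z) z)
      (nhdsWithin (0:ℝ) (Set.Ioi 0)) (nhds (∫ z, symmDiffAt f x z * K z)) := by
    refine tendsto_integral_filter_of_dominated_convergence
      (fun z => ‖symmDiffAt f x z * K z‖) ?_ ?_ hInt.norm ?_
    · exact Eventually.of_forall fun ε => hInt.aestronglyMeasurable.indicator (hA ε)
    · exact Eventually.of_forall fun ε => Eventually.of_forall fun z => norm_indicator_le_norm_self _ _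
    · refine Eventually.of_forall fun z => tendsto_const_nhds.congr' ?_
      by_cases hz : z = 0
      · refine Eventually.of_forall fun ε => ?_
        have : symmDiffAt f x z = 0 := by simp [symmDiffAt, hz]
        by_cases h : z ∈ A ε <;> simp [h, this]
      · have : ∀ᶠ ε in nhdsWithin (0:ℝ) (Set.Ioi 0), ε < ‖z‖ :=
          nhdsWithin_le_nhds (gt_mem_nhds (norm_pos_iff.2 hz))
        filter_upwards [this] with ε hε
        rw [indicator_of_mem (show z ∈ A ε from hε.le)]
  have : Tendsto (fun ε => ∫ y in {y : En n | ε ≤ dist y x}, (f x - f y) * (cns n s * K (x - y)))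
      (nhdsWithin (0:ℝ) (Set.Ioi 0)) (nhds (cns n s * ∫ z, symmDiffAt f x z * K z)) :=
    (hlim.const_mul (cns n s)).congr' (by
      filter_upwards [self_mem_nhdsWithin] with ε hε using (htrunc ε hε).symm)
  exact this.limUnder_eq

lemma cns_nonneg (n : ℕ) {s : ℝ} (hs : s ∈ Set.Ioo (0:ℝ) 1) : 0 ≤ cns n s := by
  obtain ⟨h0, h1⟩ := hs
  have g1 : 0 < Real.Gamma ((n:ℝ)/2 + s) := Real.Gamma_pos_of_pos (by positivity)
  have g2 : 0 < Real.Gamma (1 - s) := Real.Gamma_pos_of_pos (by linarith)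
  unfold cns
  positivity

/-- The `C¹` bump `z ↦ (r² - |z|²)₊²`. -/
def bump {n : ℕ} (r : ℝ) (z : En n) : ℝ := (max (r ^ 2 - ‖z‖ ^ 2) 0) ^ 2

lemma continuous_bump {n : ℕ} (r : ℝ) : Continuous (bump r : En n → ℝ) := by
  unfold bump; fun_prop

lemma bump_nonneg {n : ℕ} (r : ℝ) (z : En n) : 0 ≤ bump r z := sq_nonneg _

lemma bump_neg {n : ℕ} (r : ℝ) (z : En n) : bump r (-z) = bump r z := by simp [bump]

lemma integral_radial_profile_pos {p : ℝ} (hp : 5 < p) :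
    IntegrableOn (fun t : ℝ => (max (t ^ 2 - 1) 0) ^ 2 * t ^ (-p)) (Ioi 0) ∧
      0 < ∫ t in Ioi (0:ℝ), (max (t ^ 2 - 1) 0) ^ 2 * t ^ (-p) := by
  have hnn : ∀ t ∈ Ioi (0:ℝ), 0 ≤ (max (t ^ 2 - 1) 0) ^ 2 * t ^ (-p) := fun t ht =>
    mul_nonneg (sq_nonneg _) (Real.rpow_nonneg (le_of_lt ht) _)
  have hint : IntegrableOn (fun t : ℝ => (max (t ^ 2 - 1) 0) ^ 2 * t ^ (-p)) (Ioi 0) := by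
    rw [← Ioc_union_Ioi_eq_Ioi (zero_le_one' ℝ)]
    refine IntegrableOn.union ?_ ?_
    · refine integrableOn_zero.congr_fun (fun t ht => ?_) measurableSet_Ioc
      have : t ^ 2 - 1 ≤ 0 := by nlinarith [ht.1, ht.2]
      simp [max_eq_right this]
    · have hI : IntegrableOn (fun t : ℝ => t ^ (4 - p)) (Ioi 1) :=
        integrableOn_Ioi_rpow_of_lt (by linarith) one_pos
      refine Integrable.mono' hI (by fun_prop) ?_
      refine ae_restrict_of_forall_mem measurableSet_Ioi fun t ht => ?_
      have ht1 : 1 < t := ht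
      have ht0 : 0 < t := by linarith
      rw [Real.norm_of_nonneg (hnn t ht0), sub_eq_add_neg 4 p, Real.rpow_add ht0]
      refine mul_le_mul_of_nonneg_right ?_ (Real.rpow_nonneg ht0.le _)
      rw [max_eq_left (by nlinarith)]
      have : t ^ (4:ℝ) = (t ^ 2) ^ 2 := by
        rw [← pow_mul]; exact_mod_cast Real.rpow_natCast t 4
      rw [this]
      exact pow_le_pow_left₀ (by nlinarith) (by linarith) 2
  refine ⟨hint, ?_⟩
  rw [setIntegral_pos_iff_support_of_nonneg_ae
    (ae_restrict_of_forall_mem measurableSet_Ioi hnn) hint]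
  have : Ioo (1:ℝ) 2 ⊆ Function.support (fun t : ℝ => (max (t ^ 2 - 1) 0) ^ 2 * t ^ (-p)) ∩ Ioi 0 := by
    intro t ht
    have ht0 : 0 < t := by linarith [ht.1]
    refine ⟨?_, ht0⟩
    have : 0 < t ^ 2 - 1 := by nlinarith [ht.1]
    rw [Function.mem_support, max_eq_left this.le]
    have := Real.rpow_pos_of_pos ht0 (-p)
    positivity
  exact lt_of_lt_of_le (by simp) (measure_mono this)

lemma bump_norm_mul {n : ℕ} (t : ℝ) (z : En n) :
    bump (‖z‖ * t) z = ‖z‖ ^ 4 * (max (t ^ 2 - 1) 0) ^ 2 := by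
  have : (‖z‖ * t) ^ 2 - ‖z‖ ^ 2 = ‖z‖ ^ 2 * (t ^ 2 - 1) := by ring
  have h2 : max (‖z‖ ^ 2 * (t ^ 2 - 1)) 0 = ‖z‖ ^ 2 * max (t ^ 2 - 1) 0 := by
    rw [mul_max_of_nonneg _ _ (sq_nonneg ‖z‖), mul_zero]
  rw [bump, this, h2]
  ring

/-- A power of the norm is a superposition of bumps. -/
lemma integral_bump_mul_rpow {n : ℕ} {p : ℝ} (hp : 5 < p) {z : En n} (hz : z ≠ 0) :
    IntegrableOn (fun r : ℝ => bump r z * r ^ (-p)) (Ioi 0) ∧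
      ∫ r in Ioi (0:ℝ), bump r z * r ^ (-p)
        = ‖z‖ ^ (5 - p) * ∫ t in Ioi (0:ℝ), (max (t ^ 2 - 1) 0) ^ 2 * t ^ (-p) := by
  have hz0 : 0 < ‖z‖ := norm_pos_iff.2 hz
  have hpow : ‖z‖ ^ (4 - p) = ‖z‖ ^ 4 * ‖z‖ ^ (-p) := by
    rw [sub_eq_add_neg, Real.rpow_add hz0]
    congr 1
    exact_mod_cast Real.rpow_natCast ‖z‖ 4
  have hsc : EqOn (fun t : ℝ => ‖z‖ ^ (4 - p) * ((max (t ^ 2 - 1) 0) ^ 2 * t ^ (-p)))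
      (fun t => bump (‖z‖ * t) z * (‖z‖ * t) ^ (-p)) (Ioi 0) := by
    intro t ht
    have ht0 : (0:ℝ) < t := ht
    simp only [bump_norm_mul, Real.mul_rpow hz0.le ht0.le, hpow]
    ring
  obtain ⟨hi, -⟩ := integral_radial_profile_pos hp
  constructor
  · have := (integrableOn_Ioi_comp_mul_left_iff (fun r : ℝ => bump r z * r ^ (-p)) 0 hz0).1
      (IntegrableOn.congr_fun (hi.const_mul _) hsc measurableSet_Ioi)
    simpa using this
  · have := integral_comp_mul_left_Ioi' (fun r : ℝ => bump r z * r ^ (-p)) 0 hz0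
    rw [mul_zero] at this
    rw [← this, ← setIntegral_congr_fun measurableSet_Ioi hsc, integral_const_mul, smul_eq_mul,
      ← mul_assoc]
    congr 1
    rw [← Real.rpow_one_add' hz0.le (by linarith)]
    congr 1
    ring

lemma integral_mul_rpow_nonneg {n : ℕ} (hn : 0 < n) {s : ℝ} (hs : s ∈ Set.Ioo (0:ℝ) 1)
    {H : En n → ℝ} (hH : Continuous H) {C : ℝ} (hC : ∀ z, |H z| ≤ C * min 1 (‖z‖ ^ 2))
    (hpos : ∀ r > 0, 0 ≤ ∫ z, H z * bump r z) :
    0 ≤ ∫ z, H z * ‖z‖ ^ (-((n:ℝ) + 2 * s)) := by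
  have : Nonempty (Fin n) := ⟨⟨0, hn⟩⟩
  set p : ℝ := n + 2 * s + 5 with hp
  have hp5 : 5 < p := by have h1 := hs.1; have h2 : (0:ℝ) ≤ n := n.cast_nonneg; linarith
  obtain ⟨-, hBpos⟩ := integral_radial_profile_pos hp5
  set B := ∫ t in Ioi (0:ℝ), (max (t ^ 2 - 1) 0) ^ 2 * t ^ (-p)
  have hexp : 5 - p = -((n:ℝ) + 2 * s) := by rw [hp]; ring
  have hne : ∀ᵐ z : En n, z ≠ 0 := by
    simp [ae_iff]
  have hinner : ∀ᵐ z : En n, ∫ r in Ioi (0:ℝ), H z * (bump r z * r ^ (-p))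
      = B * (H z * ‖z‖ ^ (-((n:ℝ) + 2 * s))) := by
    filter_upwards [hne] with z hz
    rw [integral_const_mul, (integral_bump_mul_rpow hp5 hz).2, hexp]
    ring
  have hInt := integrable_mul_rpow_of_le hn hs hH.aestronglyMeasurable hC
  have hprod : Integrable (Function.uncurry fun (z : En n) (r : ℝ) => H z * (bump r z * r ^ (-p)))
      (volume.prod (volume.restrict (Ioi 0))) := by
    rw [integrable_prod_iff]
    · constructor
      · filter_upwards [hne] with z hz
        exact Integrable.const_mul (integral_bump_mul_rpow hp5 hz).1 (H z)
      · refine (hInt.norm.const_mul B).congr ?_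
        filter_upwards [hne] with z hz
        have : ∫ r in Ioi (0:ℝ), ‖H z * (bump r z * r ^ (-p))‖
            = ∫ r in Ioi (0:ℝ), |H z| * (bump r z * r ^ (-p)) := by
          refine setIntegral_congr_fun measurableSet_Ioi fun r hr => ?_
          have h1 : 0 ≤ bump r z * r ^ (-p) :=
            mul_nonneg (bump_nonneg _ _) (Real.rpow_nonneg (le_of_lt hr) _)
          simp only [Real.norm_eq_abs, abs_mul (H z), abs_of_nonneg h1]
        simp only [Function.uncurry_apply_pair]
        rw [this, integral_const_mul, (integral_bump_mul_rpow hp5 hz).2, hexp, Real.norm_eq_abs,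
          abs_mul, abs_of_nonneg (Real.rpow_nonneg (norm_nonneg z) _)]
        ring
    · refine Measurable.aestronglyMeasurable ?_
      have := hH.measurable
      simp only [Function.uncurry_def, bump]
      fun_prop
  have key : 0 ≤ B * ∫ z, H z * ‖z‖ ^ (-((n:ℝ) + 2 * s)) := by
    rw [← integral_const_mul, ← integral_congr_ae hinner, integral_integral_swap hprod]
    refine setIntegral_nonneg measurableSet_Ioi fun r hr => ?_
    simp only [← mul_assoc]
    rw [integral_mul_const]
    exact mul_nonneg (hpos r hr) (Real.rpow_nonneg (le_of_lt hr) _)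
  exact nonneg_of_mul_nonneg_right key hBpos

lemma abs_sq_posPart_sub_le (a t : ℝ) :
    |(max t 0) ^ 2 - (max a 0) ^ 2 - 2 * max a 0 * (t - a)| ≤ (t - a) ^ 2 := by
  rcases le_total t 0 with ht | ht <;> rcases le_total a 0 with ha | ha <;>
    simp only [ht, ha, max_eq_left, max_eq_right] <;> rw [abs_le] <;> constructor <;> nlinarith

lemma hasDerivAt_sq_posPart (a : ℝ) :
    HasDerivAt (fun t : ℝ => (max t 0) ^ 2) (2 * max a 0) a := by
  rw [hasDerivAt_iff_isLittleO]
  refine Asymptotics.IsBigO.trans_isLittleO ?_ (Asymptotics.isLittleO_pow_sub_sub a one_lt_two)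
  refine Asymptotics.IsBigO.of_bound 1 (Eventually.of_forall fun t => ?_)
  have := abs_sq_posPart_sub_le a t
  rw [Real.norm_eq_abs, norm_pow, norm_norm, Real.norm_eq_abs (t - a), sq_abs, smul_eq_mul, one_mul,
    mul_comm (t - a)]
  exact this

lemma hasFDerivAt_bump {n : ℕ} (r : ℝ) (z : En n) :
    HasFDerivAt (bump r)
      ((2 * max (r ^ 2 - ‖z‖ ^ 2) 0) • (-(2 • innerSL ℝ z) : En n →L[ℝ] ℝ)) z := by
  have h1 : HasFDerivAt (fun z : En n => r ^ 2 - ‖z‖ ^ 2) (-(2 • innerSL ℝ z)) z :=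
    (hasStrictFDerivAt_norm_sq z).hasFDerivAt.const_sub (r ^ 2)
  exact (hasDerivAt_sq_posPart (r ^ 2 - ‖z‖ ^ 2)).comp_hasFDerivAt z h1

lemma fderiv_bump_apply {n : ℕ} (r : ℝ) (z e : En n) :
    fderiv ℝ (bump r) z e = -4 * max (r ^ 2 - ‖z‖ ^ 2) 0 * inner ℝ z e := by
  rw [(hasFDerivAt_bump r z).fderiv]
  simp
  ring

lemma bump_eq_zero {n : ℕ} {r : ℝ} (hr : 0 ≤ r) {z : En n} (hz : r ≤ ‖z‖) : bump r z = 0 := by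
  have : r ^ 2 - ‖z‖ ^ 2 ≤ 0 := by nlinarith
  simp [bump, max_eq_right this]

lemma hasCompactSupport_bump {n : ℕ} {r : ℝ} (hr : 0 ≤ r) :
    HasCompactSupport (bump r : En n → ℝ) := by
  refine HasCompactSupport.intro (isCompact_closedBall (0 : En n) r) fun z hz => ?_
  refine bump_eq_zero hr (le_of_lt ?_)
  simpa using hz

lemma integrable_mul_bump {n : ℕ} {r : ℝ} (hr : 0 ≤ r) {f : En n → ℝ} (hf : Continuous f) :
    Integrable (fun z => f z * bump r z) :=
  (hf.mul (continuous_bump r)).integrable_of_hasCompactSupport (hasCompactSupport_bump hr).mul_left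

lemma integral_continuousLinearMap_mul_bump {n : ℕ} (r : ℝ) (L : En n →L[ℝ] ℝ) :
    ∫ z, L z * bump r z = 0 := by
  have h := integral_neg_eq_self (fun z => L z * bump r z) (volume : Measure (En n))
  simp only [map_neg, bump_neg, neg_mul, integral_neg] at h
  linarith

lemma volume_ball_le_integral_bump {n : ℕ} (hn : 0 < n) {r : ℝ} (hr : 0 < r) :
    16 * r ^ 4 * volume.real (ball (0 : En n) r) ≤ 32 * 2 ^ n * ∫ z : En n, bump r z := by
  have : Nonempty (Fin n) := ⟨⟨0, hn⟩⟩
  have hvol : volume.real (ball (0 : En n) r) = 2 ^ n * volume.real (ball (0 : En n) (r / 2)) := by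
    simp only [measureReal_def]
    rw [Measure.addHaar_ball _ _ hr.le, Measure.addHaar_ball _ _ (by positivity : 0 ≤ r / 2)]
    simp only [finrank_euclideanSpace, Fintype.card_fin, ENNReal.toReal_mul]
    rw [ENNReal.toReal_ofReal (by positivity), ENNReal.toReal_ofReal (by positivity), ← mul_assoc,
      ← mul_pow]
    congr 2
    ring
  have hint : Integrable (bump r : En n → ℝ) :=
    (continuous_bump r).integrable_of_hasCompactSupport (hasCompactSupport_bump hr.le)
  have hlow : volume.real (ball (0 : En n) (r / 2)) * (9 / 16 * r ^ 4) ≤ ∫ z : En n, bump r z := by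
    calc volume.real (ball (0 : En n) (r / 2)) * (9 / 16 * r ^ 4)
        = ∫ _ in ball (0 : En n) (r / 2), (9 / 16 * r ^ 4) := by
          rw [setIntegral_const, smul_eq_mul]
      _ ≤ ∫ z in ball (0 : En n) (r / 2), bump r z := by
          refine setIntegral_mono_on (integrableOn_const (by simp [measure_ball_lt_top.ne]))
            hint.integrableOn measurableSet_ball fun z hz => ?_
          have hz' : ‖z‖ < r / 2 := by simpa using hz
          have h1 : 3 / 4 * r ^ 2 ≤ r ^ 2 - ‖z‖ ^ 2 := by nlinarith [norm_nonneg z]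
          have h2 : 3 / 4 * r ^ 2 ≤ max (r ^ 2 - ‖z‖ ^ 2) 0 := h1.trans (le_max_left _ _)
          have h3 := pow_le_pow_left₀ (by positivity) h2 2
          rw [bump]
          linarith [show (3 / 4 * r ^ 2) ^ 2 = 9 / 16 * r ^ 4 by ring]
      _ ≤ ∫ z : En n, bump r z :=
          setIntegral_le_integral hint (Eventually.of_forall (bump_nonneg r))
  have hv0 : 0 ≤ volume.real (ball (0 : En n) (r / 2)) := measureReal_nonneg
  have : 16 * r ^ 4 * volume.real (ball (0 : En n) (r / 2)) ≤ 32 * ∫ z : En n, bump r z := by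
    nlinarith [mul_nonneg hv0 (by positivity : 0 ≤ r ^ 4)]
  rw [hvol]
  have h2 : (0:ℝ) < 2 ^ n := by positivity
  nlinarith [mul_le_mul_of_nonneg_left this h2.le]

/-- Averages of `∂_e v` are controlled, through integration by parts, by the averaged squared
increments of `v`. -/
lemma integral_dd_mul_bump_le {n : ℕ} (hn : 0 < n) {v : En n → ℝ} (hv : ContDiff ℝ 1 v)
    {e : En n} (he : ‖e‖ = 1) (x : En n) {r τ : ℝ} (hr : 0 < r) (hτ : 0 < τ) :
    2 * ∫ z, dd n e v (x + z) * bump r z ≤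
      τ * (∫ z, (v (x + z) - v x) ^ 2 * bump r z)
        + 32 * 2 ^ n / (r ^ 2 * τ) * ∫ z : En n, bump r z := by
  have hvc : Continuous v := hv.continuous
  have hdc : Continuous (dd n e v) := (hv.continuous_fderiv one_ne_zero).clm_apply continuous_const
  have hf : ∀ z, HasFDerivAt (fun z => v (x + z) - v x) (fderiv ℝ v (x + z)) z := by
    intro z
    have := (hv.differentiable one_ne_zero (x + z)).hasFDerivAt.comp z
      ((hasFDerivAt_id z).const_add x)
    simpa using this.sub_const (v x)
  have hfc : Continuous fun z => v (x + z) - v x := by fun_prop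
  have hbump' : (fun z : En n => fderiv ℝ (bump r) z e)
      = fun z => -4 * max (r ^ 2 - ‖z‖ ^ 2) 0 * inner ℝ z e := by
    ext z; exact fderiv_bump_apply r z e
  have hsupp' : HasCompactSupport fun z : En n => fderiv ℝ (bump r) z e :=
    (hasCompactSupport_bump hr.le).fderiv_apply ℝ e
  have hc' : Continuous fun z : En n => fderiv ℝ (bump r) z e := by
    rw [hbump']; fun_prop
  have hint1 : Integrable fun z => (v (x + z) - v x) * fderiv ℝ (bump r) z e :=
    (hfc.mul hc').integrable_of_hasCompactSupport hsupp'.mul_left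
  have ibp := integral_mul_fderiv_eq_neg_fderiv_mul_of_integrable
    (μ := (volume : Measure (En n))) (f := fun z => v (x + z) - v x) (g := bump r) (v := e)
    (by
      simp only [(hf _).fderiv]
      exact integrable_mul_bump (f := fun z => dd n e v (x + z)) hr.le (by fun_prop))
    hint1 (integrable_mul_bump hr.le hfc)
    (fun z _ => (hf z).differentiableAt) (fun z _ => (hasFDerivAt_bump r z).differentiableAt)
  simp only [(hf _).fderiv] at ibp
  have hX := integrable_mul_bump hr.le (f := fun z => (v (x + z) - v x) ^ 2) (by fun_prop)
  have hball : Integrable ((ball (0 : En n) r).indicator fun _ => 16 * r ^ 2 / τ) :=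
    (integrable_indicator_iff measurableSet_ball).2
      (integrableOn_const (by simp [measure_ball_lt_top.ne]))
  have hmono : ∫ z, -2 * ((v (x + z) - v x) * fderiv ℝ (bump r) z e) ≤
      ∫ z, (τ * ((v (x + z) - v x) ^ 2 * bump r z)
        + (ball (0 : En n) r).indicator (fun _ => 16 * r ^ 2 / τ) z) := by
    refine integral_mono (hint1.const_mul _) ((hX.const_mul _).add hball) fun z => ?_
    simp only [fderiv_bump_apply, bump]
    set f := v (x + z) - v x
    set w : ℝ := inner ℝ z e
    by_cases hz : ‖z‖ < r
    · rw [indicator_of_mem (by simpa using hz)]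
      set t := max (r ^ 2 - ‖z‖ ^ 2) 0
      have hw : w ^ 2 ≤ r ^ 2 := by
        have h1 : |w| ≤ ‖z‖ * ‖e‖ := abs_real_inner_le_norm z e
        rw [he, mul_one] at h1
        exact sq_le_sq' (by linarith [neg_abs_le w]) (by linarith [le_abs_self w])
      have h2 : 0 ≤ (τ * (f * t) - 4 * w) ^ 2 := sq_nonneg _
      have h3 : 0 ≤ (τ * (f * t) - 4 * w) ^ 2 / τ + 16 * (r ^ 2 - w ^ 2) / τ :=
        add_nonneg (by positivity) (div_nonneg (by linarith) hτ.le)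
      have h4 : (τ * (f * t) - 4 * w) ^ 2 / τ + 16 * (r ^ 2 - w ^ 2) / τ
          = τ * (f ^ 2 * t ^ 2) + 16 * r ^ 2 / τ - 8 * f * t * w := by
        field_simp; ring
      linarith
    · have : r ^ 2 - ‖z‖ ^ 2 ≤ 0 := by nlinarith [not_lt.1 hz]
      rw [indicator_of_notMem (by simpa using hz), max_eq_right this]
      simp
  rw [integral_const_mul, ibp, integral_add (hX.const_mul _) hball, integral_const_mul,
    integral_indicator measurableSet_ball, setIntegral_const, smul_eq_mul] at hmono
  have hvol := volume_ball_le_integral_bump hn hr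
  have hlast : volume.real (ball (0 : En n) r) * (16 * r ^ 2 / τ)
      ≤ 32 * 2 ^ n / (r ^ 2 * τ) * ∫ z : En n, bump r z := by
    have : volume.real (ball (0 : En n) r) * (16 * r ^ 2 / τ)
        = 16 * r ^ 4 * volume.real (ball (0 : En n) r) / (r ^ 2 * τ) := by
      field_simp
    rw [this, div_mul_eq_mul_div]
    exact div_le_div_of_nonneg_right hvol (by positivity)
  have hdd : ∫ z, fderiv ℝ v (x + z) e * bump r z = ∫ z, dd n e v (x + z) * bump r z := rfl
  rw [hdd] at hmono
  linarith

lemma taylor_two_of_norm_fderiv_fderiv_le {n : ℕ} {f : En n → ℝ} (hf : ContDiff ℝ 2 f) {x : En n}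
    {R C : ℝ} (hC : ∀ y ∈ closedBall x R, ‖fderiv ℝ (fderiv ℝ f) y‖ ≤ C) {z : En n}
    (hz : ‖z‖ ≤ R) : |f (x + z) - f x - fderiv ℝ f x z| ≤ C * ‖z‖ ^ 2 := by
  have hC0 : 0 ≤ C := (norm_nonneg (fderiv ℝ (fderiv ℝ f) x)).trans
    (hC x (mem_closedBall_self ((norm_nonneg _).trans hz)))
  have hdf : Differentiable ℝ f := hf.differentiable two_ne_zero
  have hddf : Differentiable ℝ (fderiv ℝ f) :=
    (hf.fderiv_right (m := 1) (by norm_num)).differentiable one_ne_zero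
  have hsub : closedBall x ‖z‖ ⊆ closedBall x R := closedBall_subset_closedBall hz
  have hx : x ∈ closedBall x ‖z‖ := mem_closedBall_self (norm_nonneg _)
  have hxz : x + z ∈ closedBall x ‖z‖ := by simp
  have h1 : ∀ y ∈ closedBall x ‖z‖, ‖fderiv ℝ f y - fderiv ℝ f x‖ ≤ C * ‖z‖ := fun y hy =>
    ((convex_closedBall x ‖z‖).norm_image_sub_le_of_norm_fderiv_le (fun w _ => hddf w)
      (fun w hw => hC w (hsub hw)) hx hy).trans
      (mul_le_mul_of_nonneg_left (by simpa [dist_eq_norm] using hy) hC0)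
  have h2 := (convex_closedBall x ‖z‖).norm_image_sub_le_of_norm_fderiv_le' (fun w _ => hdf w)
    h1 hx hxz
  rw [add_sub_cancel_left, Real.norm_eq_abs] at h2
  linarith [show C * ‖z‖ * ‖z‖ = C * ‖z‖ ^ 2 by ring]

/-- `f` has a first-order Taylor expansion at `x` with quadratic remainder on the unit ball. -/
def HasQuadraticExpansion {n : ℕ} (f : En n → ℝ) (x : En n) : Prop :=
  ∃ L : En n →L[ℝ] ℝ, ∃ C : ℝ, 0 ≤ C ∧ ∀ z, ‖z‖ ≤ 1 → |f (x + z) - f x - L z| ≤ C * ‖z‖ ^ 2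

lemma ContDiff.hasQuadraticExpansion {n : ℕ} {f : En n → ℝ} (hf : ContDiff ℝ 2 f) (x : En n) :
    HasQuadraticExpansion f x := by
  have hc : Continuous fun y => ‖fderiv ℝ (fderiv ℝ f) y‖ :=
    ((hf.fderiv_right (m := 1) (by norm_num)).continuous_fderiv one_ne_zero).norm
  obtain ⟨C, hC⟩ := (isCompact_closedBall x 1).bddAbove_image hc.continuousOn
  have hC' : ∀ y ∈ closedBall x 1, ‖fderiv ℝ (fderiv ℝ f) y‖ ≤ C := fun y hy =>
    hC (mem_image_of_mem _ hy)
  exact ⟨fderiv ℝ f x, C,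
    (norm_nonneg (fderiv ℝ (fderiv ℝ f) x)).trans (hC' x (mem_closedBall_self zero_le_one)),
    fun z hz => taylor_two_of_norm_fderiv_fderiv_le hf hC' hz⟩

namespace HasQuadraticExpansion

variable {n : ℕ} {f g : En n → ℝ} {x : En n}

lemma exists_norm_sub_le (hf : HasQuadraticExpansion f x) :
    ∃ D, 0 ≤ D ∧ ∀ z, ‖z‖ ≤ 1 → |f (x + z) - f x| ≤ D * ‖z‖ := by
  obtain ⟨L, C, hC, h⟩ := hf
  refine ⟨‖L‖ + C, by positivity, fun z hz => ?_⟩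
  have h1 := h z hz
  have h2 : |L z| ≤ ‖L‖ * ‖z‖ := L.le_opNorm z
  have h3 : ‖z‖ ^ 2 ≤ ‖z‖ := by nlinarith [norm_nonneg z]
  calc |f (x + z) - f x| = |(f (x + z) - f x - L z) + L z| := by ring_nf
    _ ≤ |f (x + z) - f x - L z| + |L z| := abs_add_le _ _
    _ ≤ (‖L‖ + C) * ‖z‖ := by nlinarith

lemma add (hf : HasQuadraticExpansion f x) (hg : HasQuadraticExpansion g x) :
    HasQuadraticExpansion (fun y => f y + g y) x := by
  obtain ⟨L, C, hC, h⟩ := hf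
  obtain ⟨L', C', hC', h'⟩ := hg
  refine ⟨L + L', C + C', by positivity, fun z hz => ?_⟩
  calc |f (x + z) + g (x + z) - (f x + g x) - (L + L') z|
      = |(f (x + z) - f x - L z) + (g (x + z) - g x - L' z)| := by
        rw [_root_.add_apply]; ring_nf
    _ ≤ |f (x + z) - f x - L z| + |g (x + z) - g x - L' z| := abs_add_le _ _
    _ ≤ (C + C') * ‖z‖ ^ 2 := by linarith [h z hz, h' z hz]

lemma mul (hf : HasQuadraticExpansion f x) (hg : HasQuadraticExpansion g x) :
    HasQuadraticExpansion (fun y => f y * g y) x := by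
  obtain ⟨D, hD, hfD⟩ := hf.exists_norm_sub_le
  obtain ⟨D', hD', hgD⟩ := hg.exists_norm_sub_le
  obtain ⟨L, C, hC, h⟩ := hf
  obtain ⟨L', C', hC', h'⟩ := hg
  refine ⟨f x • L' + g x • L, |f x| * C' + |g x| * C + D * D', by positivity, fun z hz => ?_⟩
  have e : f (x + z) * g (x + z) - f x * g x - (f x • L' + g x • L) z
      = f x * (g (x + z) - g x - L' z) + g x * (f (x + z) - f x - L z)
        + (f (x + z) - f x) * (g (x + z) - g x) := by
    simp only [_root_.add_apply, _root_.smul_apply, smul_eq_mul]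
    ring
  rw [e]
  refine (abs_add_three _ _ _).trans ?_
  rw [abs_mul, abs_mul, abs_mul]
  have h1 := mul_le_mul_of_nonneg_left (h' z hz) (abs_nonneg (f x))
  have h2 := mul_le_mul_of_nonneg_left (h z hz) (abs_nonneg (g x))
  have h3 := mul_le_mul (hfD z hz) (hgD z hz) (abs_nonneg _) (by positivity)
  calc _ ≤ |f x| * (C' * ‖z‖ ^ 2) + |g x| * (C * ‖z‖ ^ 2) + D * ‖z‖ * (D' * ‖z‖) := by linarith
    _ = _ := by ring

lemma sq_posPart (hf : HasQuadraticExpansion f x) :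
    HasQuadraticExpansion (fun y => (max (f y) 0) ^ 2) x := by
  obtain ⟨D, hD, hfD⟩ := hf.exists_norm_sub_le
  obtain ⟨L, C, hC, h⟩ := hf
  have hm : 0 ≤ max (f x) 0 := le_max_right _ _
  refine ⟨(2 * max (f x) 0) • L, D ^ 2 + 2 * max (f x) 0 * C, by positivity, fun z hz => ?_⟩
  have e : (max (f (x + z)) 0) ^ 2 - (max (f x) 0) ^ 2 - ((2 * max (f x) 0) • L) z
      = ((max (f (x + z)) 0) ^ 2 - (max (f x) 0) ^ 2 - 2 * max (f x) 0 * (f (x + z) - f x))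
        + 2 * max (f x) 0 * (f (x + z) - f x - L z) := by
    simp only [_root_.smul_apply, smul_eq_mul]
    ring
  rw [e]
  refine (abs_add_le _ _).trans ?_
  have h1 := abs_sq_posPart_sub_le (f x) (f (x + z))
  have h2 : (f (x + z) - f x) ^ 2 ≤ (D * ‖z‖) ^ 2 := by
    rw [← sq_abs]; exact pow_le_pow_left₀ (abs_nonneg _) (hfD z hz) 2
  rw [abs_mul, abs_of_nonneg (by positivity : 0 ≤ 2 * max (f x) 0)]
  have h3 := mul_le_mul_of_nonneg_left (h z hz) (by positivity : 0 ≤ 2 * max (f x) 0)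
  calc _ ≤ (D * ‖z‖) ^ 2 + 2 * max (f x) 0 * (C * ‖z‖ ^ 2) := by linarith
    _ = _ := by ring

lemma exists_symmDiffAt_le (hf : HasQuadraticExpansion f x) {B : ℝ} (hB : ∀ y, |f y| ≤ B) :
    ∃ C, ∀ z, |symmDiffAt f x z| ≤ C * min 1 (‖z‖ ^ 2) := by
  obtain ⟨L, C, hC, h⟩ := hf
  have hB0 : 0 ≤ B := (abs_nonneg _).trans (hB x)
  refine ⟨C + 2 * B, fun z => ?_⟩
  rcases le_total ‖z‖ 1 with hz | hz
  · rw [min_eq_right (by nlinarith [norm_nonneg z])]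
    have h1 := abs_le.1 (h z hz)
    have h2 := abs_le.1 (h (-z) (by simpa using hz))
    rw [norm_neg, map_neg, ← sub_eq_add_neg] at h2
    have h3 : 0 ≤ 2 * B * ‖z‖ ^ 2 := by positivity
    rw [symmDiffAt, abs_le]
    constructor <;> linarith [h1.1, h1.2, h2.1, h2.2]
  · rw [min_eq_left (by nlinarith), mul_one, symmDiffAt, abs_le]
    have h1 := abs_le.1 (hB x)
    have h2 := abs_le.1 (hB (x + z))
    have h3 := abs_le.1 (hB (x - z))
    constructor <;> linarith [h1.1, h1.2, h2.1, h2.2, h3.1, h3.2]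

end HasQuadraticExpansion

lemma pointwise_lower_bound {p q l a b M r : ℝ} (ha : 0 < a) (hM : |p| ≤ M)
    (h1 : |q - p| ≤ M * r) (h2 : |q - p - l| ≤ M * r ^ 2) (h3 : 4 * (M * r) < |p|) :
    a ^ 2 * (2 * p * l - 14 * M ^ 2 * r ^ 2) ≤
      p ^ 2 * (a ^ 2 - 2 * a * b) + q ^ 2 * (max b 0) ^ 2 := by
  set c := max b 0
  have hbc : b ≤ c := le_max_left _ _
  have hM0 : 0 ≤ M := (abs_nonneg p).trans hM
  have hq : 3 / 4 * |p| ≤ |q| := by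
    have := abs_sub_abs_le_abs_sub p q
    rw [abs_sub_comm p q] at this
    linarith
  have hp0 : 0 < |p| := by
    have := (abs_nonneg (q - p)).trans h1
    linarith
  have hq0 : 0 < q ^ 2 := by
    rw [← sq_abs]; have : 0 < |q| := by linarith
    positivity
  have hA : q ^ 2 * (q ^ 2 - p ^ 2 - 6 * (M * r) ^ 2) ≤ p ^ 2 * (q ^ 2 - p ^ 2) := by
    have e1 : (q - p) ^ 2 ≤ (M * r) ^ 2 := by
      rw [← sq_abs]; exact pow_le_pow_left₀ (abs_nonneg _) h1 2
    have e2 : (q + p) ^ 2 ≤ 6 * q ^ 2 := by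
      have : |q + p| ≤ 7 / 3 * |q| := (abs_add_le q p).trans (by linarith)
      have := pow_le_pow_left₀ (abs_nonneg _) this 2
      rw [sq_abs, mul_pow, sq_abs] at this
      nlinarith
    have e3 := mul_le_mul e1 e2 (sq_nonneg _) (sq_nonneg _)
    nlinarith
  have hB : 2 * p * l - 2 * M ^ 2 * r ^ 2 ≤ q ^ 2 - p ^ 2 := by
    have e1 : |p * (q - p - l)| ≤ M * (M * r ^ 2) := by
      rw [abs_mul]; exact mul_le_mul hM h2 (abs_nonneg _) hM0
    nlinarith [sq_nonneg (q - p), (abs_le.1 e1).1]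
  have hD : q ^ 2 * (a ^ 2 * (q ^ 2 - p ^ 2 - 6 * (M * r) ^ 2)) ≤
      q ^ 2 * (p ^ 2 * (a ^ 2 - 2 * a * c) + q ^ 2 * c ^ 2) := by
    have := mul_le_mul_of_nonneg_left hA (sq_nonneg a)
    nlinarith [sq_nonneg (q ^ 2 * c - p ^ 2 * a)]
  have hE := le_of_mul_le_mul_left hD hq0
  have hF : p ^ 2 * (a ^ 2 - 2 * a * c) ≤ p ^ 2 * (a ^ 2 - 2 * a * b) :=
    mul_le_mul_of_nonneg_left (by nlinarith) (sq_nonneg p)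
  have hG := mul_le_mul_of_nonneg_left hB (sq_nonneg a)
  nlinarith [mul_nonneg (sq_nonneg a) (sq_nonneg (M * r))]

lemma average_lower_bound {p a σ m X Q I C₁ M r : ℝ} (ha : 0 < a) (hr : 0 < r) (hC₁ : 0 < C₁)
    (hX : 0 ≤ X) (hσ0 : 0 < σ) (hσ : 56 * C₁ * M ^ 2 ≤ σ)
    (hQ : ∀ τ > 0, 2 * Q ≤ τ * X + C₁ / (r ^ 2 * τ) * m)
    (hI : p ^ 2 * a ^ 2 * m - p ^ 2 * a * (2 * Q) + σ * X ≤ I)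
    (hI' : 4 * (M * r) < |p| → -(14 * M ^ 2 * a ^ 2 * r ^ 2 * m) + σ * X ≤ I) : 0 ≤ I := by
  have hr2 : 0 < r ^ 2 := by positivity
  rcases le_or_gt (C₁ * p ^ 2) (σ * r ^ 2) with h | h
  · have h1 := hQ (C₁ / (r ^ 2 * a)) (by positivity)
    have e : C₁ / (r ^ 2 * (C₁ / (r ^ 2 * a))) = a := by field_simp
    rw [e] at h1
    have h2 : p ^ 2 * a * (2 * Q) ≤ p ^ 2 * a * (C₁ / (r ^ 2 * a) * X + a * m) :=
      mul_le_mul_of_nonneg_left h1 (by positivity)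
    have h3 : p ^ 2 * a * (C₁ / (r ^ 2 * a) * X + a * m)
        = C₁ * p ^ 2 / r ^ 2 * X + p ^ 2 * a ^ 2 * m := by field_simp
    have h4 : C₁ * p ^ 2 / r ^ 2 ≤ σ := by rwa [div_le_iff₀ hr2]
    nlinarith [mul_le_mul_of_nonneg_right h4 hX]
  · rcases le_or_gt (2 * Q) (a * m) with h1 | h1
    · have := mul_le_mul_of_nonneg_left h1 (by positivity : 0 ≤ p ^ 2 * a)
      nlinarith [mul_nonneg hσ0.le hX]
    · have hsq : (4 * (M * r)) ^ 2 < p ^ 2 := by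
        have : C₁ * (4 * (M * r)) ^ 2 < C₁ * p ^ 2 := by
          nlinarith [mul_le_mul_of_nonneg_right hσ hr2.le,
            mul_nonneg hC₁.le (sq_nonneg (M * r))]
        exact lt_of_mul_lt_mul_left this hC₁.le
      have h2 := hI' ((le_abs_self _).trans_lt (sq_lt_sq.1 hsq))
      have h3 := hQ (2 * C₁ / (r ^ 2 * a)) (by positivity)
      have e : C₁ / (r ^ 2 * (2 * C₁ / (r ^ 2 * a))) = a / 2 := by field_simp
      rw [e] at h3
      have h4 : a / 2 * m ≤ 2 * C₁ * X / (r ^ 2 * a) := by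
        rw [← div_mul_eq_mul_div]; linarith
      rw [le_div_iff₀ (by positivity)] at h4
      have h5 : a ^ 2 * r ^ 2 * m ≤ 4 * C₁ * X := by nlinarith
      have h6 := mul_le_mul_of_nonneg_left h5 (by positivity : 0 ≤ 14 * M ^ 2)
      nlinarith [mul_le_mul_of_nonneg_right hσ hX]

/-- The Bernstein inequality, averaged against a bump of arbitrary radius. -/
lemma integral_bernstein_bump_nonneg {n : ℕ} (hn : 0 < n) {v η : En n → ℝ}
    (hv : ContDiff ℝ 1 v) (hη : ContDiff ℝ 2 η) {M : ℝ} (hM : C2BddBy n η M) {e : En n}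
    (he : ‖e‖ = 1) {σ : ℝ} (hσ0 : 0 < σ) (hσ : 56 * (32 * 2 ^ n) * M ^ 2 ≤ σ) (x : En n) {r : ℝ}
    (hr : 0 < r) :
    0 ≤ ∫ z, ((η x) ^ 2 * (2 * max (dd n e v x) 0 * (dd n e v x - dd n e v (x + z))
        - (max (dd n e v x) 0) ^ 2) + (η (x + z)) ^ 2 * (max (dd n e v (x + z)) 0) ^ 2
        + σ * (v (x + z) - v x) ^ 2) * bump r z := by
  rcases le_or_gt (dd n e v x) 0 with ha | ha
  · refine integral_nonneg fun z => mul_nonneg ?_ (bump_nonneg r z)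
    simp only [max_eq_right ha]
    have h1 := mul_nonneg hσ0.le (sq_nonneg (v (x + z) - v x))
    have h2 := mul_nonneg (sq_nonneg (η (x + z))) (sq_nonneg (max (dd n e v (x + z)) 0))
    linarith
  have hvc : Continuous v := hv.continuous
  have hηc : Continuous η := hη.continuous
  have hdc : Continuous (dd n e v) := (hv.continuous_fderiv one_ne_zero).clm_apply continuous_const
  rw [max_eq_left ha.le]
  set a := dd n e v x
  set p := η x
  have hQi := integrable_mul_bump hr.le (f := fun z => dd n e v (x + z)) (by fun_prop)
  have hXi := integrable_mul_bump hr.le (f := fun z => (v (x + z) - v x) ^ 2) (by fun_prop)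
  have hmi : Integrable (bump r : En n → ℝ) :=
    (continuous_bump r).integrable_of_hasCompactSupport (hasCompactSupport_bump hr.le)
  have hIi := integrable_mul_bump hr.le (f := fun z => p ^ 2 * (2 * a * (a - dd n e v (x + z))
        - a ^ 2) + (η (x + z)) ^ 2 * (max (dd n e v (x + z)) 0) ^ 2
        + σ * (v (x + z) - v x) ^ 2) (by fun_prop)
  refine average_lower_bound (p := p) (C₁ := 32 * 2 ^ n) ha hr (by positivity)
    (integral_nonneg fun z => mul_nonneg (sq_nonneg _) (bump_nonneg r z)) hσ0 hσ
    (fun τ hτ => integral_dd_mul_bump_le hn hv he x hr hτ) ?_ ?_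
  · have i₁ : Integrable fun z => p ^ 2 * a ^ 2 * bump r z
        - p ^ 2 * a * 2 * (dd n e v (x + z) * bump r z) :=
      (hmi.const_mul _).sub (hQi.const_mul _)
    rw [← integral_const_mul, ← mul_assoc (p ^ 2 * a) 2, ← integral_const_mul, ← integral_const_mul,
      ← integral_sub (hmi.const_mul _) (hQi.const_mul _), ← integral_add i₁ (hXi.const_mul _)]
    refine integral_mono (i₁.add (hXi.const_mul _)) hIi fun z => ?_
    have : 0 ≤ (η (x + z)) ^ 2 * (max (dd n e v (x + z)) 0) ^ 2 * bump r z :=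
      mul_nonneg (by positivity) (bump_nonneg r z)
    simp only
    nlinarith
  · intro hp
    have hLi := integrable_mul_bump hr.le (f := fun z => fderiv ℝ η x z) (by fun_prop)
    have hL := integral_continuousLinearMap_mul_bump r (fderiv ℝ η x)
    have i₁ : Integrable fun z => 2 * p * a ^ 2 * (fderiv ℝ η x z * bump r z)
        + -(14 * M ^ 2 * a ^ 2 * r ^ 2) * bump r z :=
      (hLi.const_mul _).add (hmi.const_mul _)
    have key : ∫ z, ((2 * p * a ^ 2 * (fderiv ℝ η x z * bump r z)
        + -(14 * M ^ 2 * a ^ 2 * r ^ 2) * bump r z) + σ * ((v (x + z) - v x) ^ 2 * bump r z)) ≤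
        ∫ z, (p ^ 2 * (2 * a * (a - dd n e v (x + z))
        - a ^ 2) + (η (x + z)) ^ 2 * (max (dd n e v (x + z)) 0) ^ 2
        + σ * (v (x + z) - v x) ^ 2) * bump r z := by
      refine integral_mono (i₁.add (hXi.const_mul _)) hIi
        fun z => ?_
      simp only
      rcases le_or_gt r ‖z‖ with hz | hz
      · simp [bump_eq_zero hr.le hz]
      · have hM0 : 0 ≤ M := (abs_nonneg _).trans (hM x).1
        have h1 : |η (x + z) - p| ≤ M * r := by
          have := (convex_univ (𝕜 := ℝ) (E := En n)).norm_image_sub_le_of_norm_fderiv_le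
            (fun y _ => hη.differentiable two_ne_zero y) (fun y _ => (hM y).2.1) (mem_univ x)
            (mem_univ (x + z))
          rw [add_sub_cancel_left] at this
          exact this.trans (mul_le_mul_of_nonneg_left hz.le hM0)
        have h2 : |η (x + z) - p - fderiv ℝ η x z| ≤ M * r ^ 2 :=
          (taylor_two_of_norm_fderiv_fderiv_le hη (fun y _ => (hM y).2.2) le_rfl).trans
            (mul_le_mul_of_nonneg_left (pow_le_pow_left₀ (norm_nonneg z) hz.le 2) hM0)
        have h3 := mul_le_mul_of_nonneg_right
          (pointwise_lower_bound (b := dd n e v (x + z)) ha (hM x).1 h1 h2 hp) (bump_nonneg r z)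
        linarith
    rw [integral_add i₁ (hXi.const_mul _),
      integral_add (hLi.const_mul _) (hmi.const_mul _), integral_const_mul, integral_const_mul,
      integral_const_mul, hL] at key
    linarith

/-- Bernstein key inequality for the fractional Laplacian, with the
positive part of the directional derivative.  For `ψ := η² ((∂_e v)₊)² + σ v²` and
`σ ≥ σ₀(n, ‖η‖_{C²})`, one has
`(-Δ)^s ψ ≤ 2 η² (∂_e v)₊ (-Δ)^s ∂_e v + 2 σ v (-Δ)^s v` everywhere in `ℝⁿ`,
with `σ₀` independent of `s ∈ (0,1)`. -/
theorem bernstein_fracLap_positive_part (n : ℕ) (hn : 0 < n) :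
    ∃ σ₀ : ℝ → ℝ, (∀ M : ℝ, 0 < σ₀ M) ∧
      ∀ (s : ℝ), s ∈ Set.Ioo (0:ℝ) 1 →
      ∀ (v η : En n → ℝ),
        ContDiff ℝ (⊤ : ℕ∞) v →
        (∃ Mv : ℝ, ∀ x, |v x| ≤ Mv ∧ ‖fderiv ℝ v x‖ ≤ Mv) →
        ContDiff ℝ (⊤ : ℕ∞) η →
      ∀ (M : ℝ), C2BddBy n η M →
      ∀ (e : En n), ‖e‖ = 1 →
      ∀ (σ : ℝ), 0 < σ → σ₀ M ≤ σ →
      ∀ x : En n,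
        fracLap n s (fun y => (η y)^2 * (max (dd n e v y) 0)^2 + σ * (v y)^2) x ≤
          2 * (η x)^2 * max (dd n e v x) 0 * fracLap n s (dd n e v) x
            + 2 * σ * v x * fracLap n s v x := by
  refine ⟨fun M => 56 * (32 * 2 ^ n) * M ^ 2 + 1, fun M => by positivity, ?_⟩
  intro s hs v η hv ⟨Mv, hMv⟩ hη M hM e he σ hσ0 hσ x
  have hv2 : ContDiff ℝ 2 v := contDiff_infty.1 hv 2
  have hη2 : ContDiff ℝ 2 η := contDiff_infty.1 hη 2
  have hu2 : ContDiff ℝ 2 (dd n e v) :=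
    ((contDiff_infty.1 hv 3).fderiv_right (m := 2) (by norm_num)).clm_apply contDiff_const
  set u := dd n e v with hu
  set a := max (u x) 0
  have hvB : ∀ y, |v y| ≤ Mv := fun y => (hMv y).1
  have hMv0 : 0 ≤ Mv := (abs_nonneg _).trans (hvB x)
  have huB : ∀ y, |u y| ≤ Mv := fun y => by
    have := (fderiv ℝ v y).le_opNorm e
    rw [he, mul_one] at this
    exact this.trans (hMv y).2
  have hψB : ∀ y, |(η y) ^ 2 * (max (u y) 0) ^ 2 + σ * (v y) ^ 2| ≤ M ^ 2 * Mv ^ 2 + σ * Mv ^ 2 := by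
    intro y
    have h1 : (η y) ^ 2 ≤ M ^ 2 := by
      rw [← sq_abs]; exact pow_le_pow_left₀ (abs_nonneg _) (hM y).1 2
    have h2 : (max (u y) 0) ^ 2 ≤ Mv ^ 2 :=
      pow_le_pow_left₀ (le_max_right _ _) (max_le ((le_abs_self _).trans (huB y)) hMv0) 2
    have h3 : (v y) ^ 2 ≤ Mv ^ 2 := by
      rw [← sq_abs]; exact pow_le_pow_left₀ (abs_nonneg _) (hvB y) 2
    rw [abs_of_nonneg (by positivity)]
    gcongr
  have huc : Continuous u := hu2.continuous
  have hvc : Continuous v := hv.continuous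
  have hηc : Continuous η := hη.continuous
  have hψc : Continuous fun y => (η y) ^ 2 * (max (u y) 0) ^ 2 + σ * (v y) ^ 2 := by fun_prop
  have hψE : HasQuadraticExpansion (fun y => (η y) ^ 2 * (max (u y) 0) ^ 2 + σ * (v y) ^ 2) x :=
    (((hη2.pow 2).hasQuadraticExpansion x).mul (hu2.hasQuadraticExpansion x).sq_posPart).add
      ((contDiff_const.mul (hv2.pow 2)).hasQuadraticExpansion x)
  obtain ⟨Cψ, hCψ⟩ := hψE.exists_symmDiffAt_le hψB
  obtain ⟨Cu, hCu⟩ := (hu2.hasQuadraticExpansion x).exists_symmDiffAt_le huB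
  obtain ⟨Cv, hCv⟩ := (hv2.hasQuadraticExpansion x).exists_symmDiffAt_le hvB
  set ψ : En n → ℝ := fun y => (η y) ^ 2 * (max (u y) 0) ^ 2 + σ * (v y) ^ 2 with hψ
  rw [fracLap_eq_integral_symmDiffAt hn hs hψc hψB hCψ,
    fracLap_eq_integral_symmDiffAt hn hs huc huB hCu,
    fracLap_eq_integral_symmDiffAt hn hs hvc hvB hCv]
  have iψ := integrable_mul_rpow_of_le hn hs (continuous_symmDiffAt hψc x).aestronglyMeasurable hCψ
  have iu := integrable_mul_rpow_of_le hn hs (continuous_symmDiffAt huc x).aestronglyMeasurable hCu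
  have iv := integrable_mul_rpow_of_le hn hs (continuous_symmDiffAt hvc x).aestronglyMeasurable hCv
  set c₁ := 2 * (η x) ^ 2 * a with hc₁
  set c₂ := 2 * σ * v x with hc₂
  let G : En n → ℝ := fun y => c₁ * u y + c₂ * v y - ψ y
  have hGc : Continuous G := by fun_prop
  have hGs : ∀ z, symmDiffAt G x z
      = c₁ * symmDiffAt u x z + c₂ * symmDiffAt v x z - symmDiffAt ψ x z := fun z => by
    simp only [symmDiffAt, G]; ring
  have hGC : ∀ z, |symmDiffAt G x z| ≤ (|c₁| * Cu + |c₂| * Cv + Cψ) * min 1 (‖z‖ ^ 2) := by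
    intro z
    rw [hGs]
    refine (abs_sub _ _).trans ?_
    have h1 := abs_add_le (c₁ * symmDiffAt u x z) (c₂ * symmDiffAt v x z)
    rw [abs_mul c₁, abs_mul c₂] at h1
    linarith [mul_le_mul_of_nonneg_left (hCu z) (abs_nonneg c₁),
      mul_le_mul_of_nonneg_left (hCv z) (abs_nonneg c₂), hCψ z]
  have hGpos : ∀ r > 0, 0 ≤ ∫ z, symmDiffAt G x z * bump r z := by
    intro r hr
    have i1 := integrable_mul_bump (le_of_lt hr) (f := fun z => G x - G (x + z)) (by fun_prop)
    have i2 := integrable_mul_bump (le_of_lt hr) (f := fun z => G x - G (x - z)) (by fun_prop)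
    have e1 : ∫ z, (G x - G (x - z)) * bump r z = ∫ z, (G x - G (x + z)) * bump r z := by
      rw [← integral_neg_eq_self]
      simp only [bump_neg, sub_neg_eq_add]
    have e2 : ∫ z, symmDiffAt G x z * bump r z = ∫ z, (G x - G (x + z)) * bump r z := by
      calc ∫ z, symmDiffAt G x z * bump r z
          = ∫ z, ((1 / 2) * ((G x - G (x + z)) * bump r z)
            + (1 / 2) * ((G x - G (x - z)) * bump r z)) := by
            congr 1; ext z; simp only [symmDiffAt]; ring
        _ = ∫ z, (G x - G (x + z)) * bump r z := by
            rw [integral_add (i1.const_mul _) (i2.const_mul _), integral_const_mul,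
              integral_const_mul, e1]
            ring
    rw [e2]
    refine (integral_bernstein_bump_nonneg hn (contDiff_infty.1 hv 1) hη2 hM he hσ0
      (by linarith) x hr).trans_eq ?_
    congr 1
    ext z
    simp only [G, hψ, hc₁, hc₂, ← hu]
    ring
  have hfin := mul_nonneg (cns_nonneg n hs)
    (integral_mul_rpow_nonneg hn hs (continuous_symmDiffAt hGc x) hGC hGpos)
  have hsplit : ∫ z, symmDiffAt G x z * ‖z‖ ^ (-((n:ℝ) + 2 * s))
      = c₁ * (∫ z, symmDiffAt u x z * ‖z‖ ^ (-((n:ℝ) + 2 * s)))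
        + c₂ * (∫ z, symmDiffAt v x z * ‖z‖ ^ (-((n:ℝ) + 2 * s)))
        - ∫ z, symmDiffAt ψ x z * ‖z‖ ^ (-((n:ℝ) + 2 * s)) := by
    have i₁ : Integrable fun z => c₁ * (symmDiffAt u x z * ‖z‖ ^ (-((n:ℝ) + 2 * s)))
        + c₂ * (symmDiffAt v x z * ‖z‖ ^ (-((n:ℝ) + 2 * s))) :=
      (iu.const_mul _).add (iv.const_mul _)
    rw [← integral_const_mul, ← integral_const_mul,
      ← integral_add (iu.const_mul _) (iv.const_mul _),
      ← integral_sub i₁ iψ]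
    congr 1
    ext z
    rw [hGs]
    ring
  rw [hsplit] at hfin
  linarith
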